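/- arXiv:1105.4891 — 2 statements merged into one kernel-verified Lean document; each statement's English description precedes it below -/
import Mathlib

section
/- Let N ≥ 1, let r be a real number, let m ≥ 0, and let x be a real number. Let exp^[i] denote the i-fold iterate of the real exponential. Then the m-th derivative at x of the function t ↦ (exp^[N] t)^r (real power) equals Σ r^{l_1} · (∏_{i=1}^{N−1} S₂(l_{i+1}, l_i)) · (exp^[N] x)^r · ∏_{i=1}^{N−1} (exp^[i] x)^{l_{N−i}}, where the sum is over all chains of natural numbers 0 ≤ l_1 ≤ l_2 ≤ ⋯ ≤ l_{N−1} ≤ l_N with l_N = m. -/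
/-- The composition formula for the Stirling number of the second kind:
`S₂(m,n) = (m!/n!) · Σ 1/(i₁!⋯iₙ!)`, the sum being over all `n`-tuples of positive
integers with `i₁ + ⋯ + iₙ = m`. -/
noncomputable def stirlingSecondComp (m n : ℕ) : ℝ :=
  (m.factorial : ℝ) / (n.factorial : ℝ) *
    ∑ f ∈ (Finset.Nat.antidiagonalTuple n m).filter (fun f => ∀ i, 0 < f i),
      ∏ i, (1 / ((f i).factorial : ℝ))

theorem Finset.Nat.sum_antidiagonalTuple_succ {M : Type*} [AddCommMonoid M] (n m : ℕ)
    (F : (Fin (n + 1) → ℕ) → M) :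
    ∑ f ∈ Finset.Nat.antidiagonalTuple (n + 1) m, F f =
      ∑ p ∈ Finset.HasAntidiagonal.antidiagonal m, ∑ g ∈ Finset.Nat.antidiagonalTuple n p.2,
        F (Fin.cons p.1 g) := by
  rw [Finset.sum_sigma']
  refine Finset.sum_nbij' (fun f => ⟨(f 0, ∑ i : Fin n, f i.succ), Fin.tail f⟩)
    (fun q => Fin.cons q.1.1 q.2) ?_ ?_ ?_ ?_ ?_
  · intro f hf
    simp_all [Finset.Nat.mem_antidiagonalTuple, Fin.sum_univ_succ, Fin.tail]
  · rintro ⟨⟨a, b⟩, g⟩ hq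
    simp_all [Finset.Nat.mem_antidiagonalTuple, Fin.sum_univ_succ]
  · intro f hf
    simp
  · rintro ⟨⟨a, b⟩, g⟩ hq
    simp_all [Finset.Nat.mem_antidiagonalTuple]
  · intro f hf
    simp

theorem PowerSeries.coeff_pow_eq_sum_antidiagonalTuple {R : Type*} [CommSemiring R]
    (p : PowerSeries R) (n m : ℕ) :
    PowerSeries.coeff m (p ^ n) =
      ∑ f ∈ Finset.Nat.antidiagonalTuple n m, ∏ i, PowerSeries.coeff (f i) p := by
  induction n generalizing m with
  | zero => cases m <;> simp [PowerSeries.coeff_one]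
  | succ n ih =>
    rw [pow_succ', PowerSeries.coeff_mul, Finset.Nat.sum_antidiagonalTuple_succ]
    simp [Fin.prod_univ_succ, ih, Finset.mul_sum]

theorem PowerSeries.coeff_exp_sub_one (k : ℕ) :
    PowerSeries.coeff k (PowerSeries.exp ℝ - 1) = if 0 < k then 1 / (k.factorial : ℝ) else 0 := by
  cases k <;> simp [PowerSeries.coeff_exp, PowerSeries.coeff_one]

theorem stirlingSecondComp_eq_coeff (m n : ℕ) :
    stirlingSecondComp m n =
      (m.factorial : ℝ) / (n.factorial : ℝ) *
        PowerSeries.coeff m ((PowerSeries.exp ℝ - 1) ^ n) := by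
  rw [stirlingSecondComp, PowerSeries.coeff_pow_eq_sum_antidiagonalTuple, Finset.sum_filter]
  congr 1
  refine Finset.sum_congr rfl fun f _ => ?_
  simp only [PowerSeries.coeff_exp_sub_one]
  split_ifs with h
  · exact Finset.prod_congr rfl fun i _ => by rw [if_pos (h i)]
  · push Not at h
    obtain ⟨i, hi⟩ := h
    exact (Finset.prod_eq_zero (Finset.mem_univ i) (if_neg hi.not_gt)).symm

theorem stirlingSecondComp_zero_right (m : ℕ) :
    stirlingSecondComp m 0 = if m = 0 then 1 else 0 := by
  rw [stirlingSecondComp_eq_coeff]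
  cases m <;> simp [PowerSeries.coeff_one]

theorem stirlingSecondComp_zero_succ (n : ℕ) : stirlingSecondComp 0 (n + 1) = 0 := by
  simp [stirlingSecondComp_eq_coeff]

theorem stirlingSecondComp_succ_succ (m n : ℕ) :
    stirlingSecondComp (m + 1) (n + 1) =
      (n + 1) * stirlingSecondComp m (n + 1) + stirlingSecondComp m n := by
  have h := PowerSeries.coeff_derivative ((PowerSeries.exp ℝ - 1) ^ (n + 1)) m
  have hd : PowerSeries.derivative ℝ ((PowerSeries.exp ℝ - 1) ^ (n + 1)) =
      ((n + 1 : ℕ) : ℝ) • ((PowerSeries.exp ℝ - 1) ^ (n + 1) + (PowerSeries.exp ℝ - 1) ^ n) := by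
    rw [PowerSeries.derivative_pow, map_sub, PowerSeries.derivative_exp,
      PowerSeries.derivative_one, PowerSeries.smul_eq_C_mul, map_natCast, Nat.add_sub_cancel]
    ring
  rw [hd, map_smul, map_add, smul_eq_mul] at h
  simp only [stirlingSecondComp_eq_coeff, Nat.factorial_succ]
  have hn : (n.factorial : ℝ) ≠ 0 := by positivity
  have hn' : (n : ℝ) + 1 ≠ 0 := by positivity
  push_cast at h ⊢
  field_simp
  linear_combination (-(1:ℝ)) * h

theorem stirlingSecondComp_eq_stirlingSecond (m n : ℕ) :
    stirlingSecondComp m n = Nat.stirlingSecond m n := by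
  induction m generalizing n with
  | zero => cases n <;> simp [stirlingSecondComp_zero_right, stirlingSecondComp_zero_succ]
  | succ m ih =>
    cases n with
    | zero => simp [stirlingSecondComp_zero_right]
    | succ n => simp [stirlingSecondComp_succ_succ, Nat.stirlingSecond_succ_succ, ih]

open scoped ContDiff

theorem iteratedDeriv_comp_exp {g : ℝ → ℝ} (hg : ContDiff ℝ ∞ g) (m : ℕ) (x : ℝ) :
    iteratedDeriv m (fun t => g (Real.exp t)) x =
      ∑ k ∈ Finset.range (m + 1),
        (Nat.stirlingSecond m k : ℝ) * Real.exp x ^ k * iteratedDeriv k g (Real.exp x) := by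
  induction m generalizing x with
  | zero => simp
  | succ m ih =>
    rw [iteratedDeriv_succ, funext ih]
    have hd (k : ℕ) : HasDerivAt
        (fun t => (Nat.stirlingSecond m k : ℝ) * Real.exp t ^ k * iteratedDeriv k g (Real.exp t))
        (k * Nat.stirlingSecond m k * Real.exp x ^ k * iteratedDeriv k g (Real.exp x) +
          Nat.stirlingSecond m k * Real.exp x ^ (k + 1) *
            iteratedDeriv (k + 1) g (Real.exp x)) x := by
      have h₁ : HasDerivAt (iteratedDeriv k g) (iteratedDeriv (k + 1) g (Real.exp x))
          (Real.exp x) := by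
        rw [iteratedDeriv_succ]
        exact (hg.differentiable_iteratedDeriv k (mod_cast WithTop.coe_lt_top _) _).hasDerivAt
      have h₂ := (((Real.hasDerivAt_exp x).pow k).const_mul (Nat.stirlingSecond m k : ℝ)).mul
        (h₁.comp x (Real.hasDerivAt_exp x))
      refine h₂.congr_deriv ?_
      cases k with
      | zero => simp; ring
      | succ k => simp; ring
    rw [(HasDerivAt.fun_sum fun k _ => hd k).deriv, Finset.sum_add_distrib,
      Finset.sum_range_succ' _ (m + 1)]
    simp only [Nat.stirlingSecond_succ_succ, Nat.stirlingSecond_succ_zero]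
    push_cast
    simp only [add_mul, Finset.sum_add_distrib]
    rw [Finset.sum_range_succ' _ m]
    simp [Finset.sum_range_succ _ m, Nat.stirlingSecond_eq_zero_of_lt, Finset.sum_add_distrib,
      add_mul]

/-- The monotone sequences `l 0 ≤ ⋯ ≤ l n` of natural numbers with `l n = m`. -/
def monotoneChains (n m : ℕ) : Finset (Fin (n + 1) → Fin (m + 1)) :=
  Finset.univ.filter fun l => (∀ i j, i ≤ j → l i ≤ l j) ∧ (l (Fin.last n) : ℕ) = m

/-- A finite sequence indexed from `0`, read as a sequence indexed from `1` and extended by `0`. -/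
def shiftedExtension {N m : ℕ} (l : Fin N → Fin (m + 1)) (i : ℕ) : ℕ :=
  if h : i - 1 < N then (l ⟨i - 1, h⟩ : ℕ) else 0

theorem sum_monotoneChains_succ {M : Type*} [AddCommMonoid M] (n m : ℕ) (φ : (ℕ → ℕ) → M) :
    ∑ l ∈ monotoneChains (n + 1) m, φ (shiftedExtension l) =
      ∑ k ∈ Finset.range (m + 1), ∑ l ∈ monotoneChains n k,
        φ (Function.update (shiftedExtension l) (n + 2) m) := by
  rw [Finset.sum_sigma']
  symm
  have hlt (q : (k : ℕ) × (Fin (n + 1) → Fin (k + 1)))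
      (hq : q ∈ (Finset.range (m + 1)).sigma fun k => monotoneChains n k) (j : Fin (n + 1)) :
      (q.2 j : ℕ) < m + 1 := by
    have h₁ := Finset.mem_range.1 (Finset.mem_sigma.1 hq).1
    have h₂ := (q.2 j).isLt
    omega
  refine Finset.sum_bij
    (fun q hq => Fin.snoc (α := fun _ => Fin (m + 1)) (fun j => ⟨q.2 j, hlt q hq j⟩) (Fin.last m))
    ?_ ?_ ?_ ?_
  · rintro ⟨k, l⟩ hq
    have hl := (Finset.mem_filter.1 (Finset.mem_sigma.1 hq).2).2
    refine Finset.mem_filter.2 ⟨Finset.mem_univ _, ?_, by simp⟩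
    intro i j hij
    induction j using Fin.lastCases with
    | last => simpa using Fin.le_last _
    | cast j =>
      induction i using Fin.lastCases with
      | last => exact absurd (lt_of_le_of_lt hij (Fin.castSucc_lt_last j)) (lt_irrefl _)
      | cast i => simpa using hl.1 i j (by simpa using hij)
  · rintro ⟨k, l⟩ hq ⟨k', l'⟩ hq' h
    have hl := (Finset.mem_filter.1 (Finset.mem_sigma.1 hq).2).2.2
    have hl' := (Finset.mem_filter.1 (Finset.mem_sigma.1 hq').2).2.2
    have hval (j : Fin (n + 1)) : (l j : ℕ) = l' j := by
      simpa using congrArg Fin.val (congrFun h j.castSucc)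
    obtain rfl : k = k' := by
      dsimp only at hl hl'
      rw [← hl, ← hl', hval]
    obtain rfl : l = l' := funext fun j => Fin.ext (hval j)
    rfl
  · intro l hl
    obtain ⟨hmono, hlast⟩ := (Finset.mem_filter.1 hl).2
    refine ⟨⟨l (Fin.last n).castSucc, fun j => ⟨l j.castSucc, Nat.lt_succ_of_le
      (hmono _ _ (Fin.castSucc_le_castSucc_iff.2 (Fin.le_last j)))⟩⟩, ?_, ?_⟩
    · refine Finset.mem_sigma.2 ⟨Finset.mem_range.2 (Fin.isLt _),
        Finset.mem_filter.2 ⟨Finset.mem_univ _, fun i j hij => ?_, rfl⟩⟩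
      exact hmono _ _ (Fin.castSucc_le_castSucc_iff.2 hij)
    · funext j
      induction j using Fin.lastCases with
      | last => simpa using Fin.ext hlast.symm
      | cast j => simp
  · rintro ⟨k, l⟩ hq
    congr 1
    funext i
    rcases lt_trichotomy (i - 1) (n + 1) with h | h | h
    · have hi : i ≠ n + 2 := by omega
      have h' : i - 1 < n + 1 + 1 := by omega
      have hc : (⟨i - 1, h'⟩ : Fin (n + 1 + 1)) = Fin.castSucc ⟨i - 1, h⟩ := rfl
      simp only [shiftedExtension, Function.update_of_ne hi, dif_pos h, dif_pos h', hc,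
        Fin.snoc_castSucc]
    · obtain rfl : i = n + 2 := by omega
      have hc : (⟨n + 2 - 1, by omega⟩ : Fin (n + 1 + 1)) = Fin.last (n + 1) := rfl
      rw [Function.update_self, shiftedExtension, dif_pos (by omega), hc, Fin.snoc_last,
        Fin.val_last]
    · have hi : i ≠ n + 2 := by omega
      simp [shiftedExtension, Function.update_of_ne hi, h.not_gt,
        show ¬ i - 1 < n + 1 + 1 by omega]

/-- The summand of the expansion of the derivative of `(exp^[N] x) ^ r` indexed by `L`. -/
noncomputable def chainTerm (N : ℕ) (r x : ℝ) (L : ℕ → ℕ) : ℝ :=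
  r ^ (L 1) *
    (∏ i ∈ Finset.Ico 1 N, stirlingSecondComp (L (i + 1)) (L i)) *
    (Real.exp^[N] x) ^ r *
    ∏ i ∈ Finset.Ico 1 N, (Real.exp^[i] x) ^ ((L (N - i) : ℝ))

theorem chainTerm_update (n m : ℕ) (r x : ℝ) (L : ℕ → ℕ) :
    chainTerm (n + 2) r x (Function.update L (n + 2) m) =
      Nat.stirlingSecond m (L (n + 1)) * Real.exp x ^ L (n + 1) *
        chainTerm (n + 1) r (Real.exp x) L := by
  have h₁ : ∏ i ∈ Finset.Ico 1 (n + 1), stirlingSecondComp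
      (Function.update L (n + 2) m (i + 1)) (Function.update L (n + 2) m i) =
      ∏ i ∈ Finset.Ico 1 (n + 1), stirlingSecondComp (L (i + 1)) (L i) := by
    refine Finset.prod_congr rfl fun i hi => ?_
    have := Finset.mem_Ico.1 hi
    rw [Function.update_of_ne (by omega), Function.update_of_ne (by omega)]
  have h₂ : ∏ i ∈ Finset.Ico 1 (n + 2),
      (Real.exp^[i] x) ^ ((Function.update L (n + 2) m (n + 2 - i) : ℝ)) =
      Real.exp x ^ L (n + 1) *
        ∏ i ∈ Finset.Ico 1 (n + 1), (Real.exp^[i] (Real.exp x)) ^ ((L (n + 1 - i) : ℝ)) := by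
    rw [Finset.prod_eq_prod_Ico_succ_bot (by omega), ← Finset.prod_Ico_add' _ 1 (n + 1) 1]
    congr 1
    · simp
    · refine Finset.prod_congr rfl fun i hi => ?_
      have := Finset.mem_Ico.1 hi
      rw [Function.update_of_ne (by omega), Function.iterate_succ_apply,
        show n + 2 - (i + 1) = n + 1 - i by omega]
  rw [chainTerm, chainTerm, h₂, Finset.prod_Ico_succ_top (by omega), h₁,
    Function.update_of_ne (show 1 ≠ n + 2 by omega), Function.update_self,
    Function.update_of_ne (show n + 1 ≠ n + 2 by omega),
    Function.iterate_succ_apply, stirlingSecondComp_eq_stirlingSecond]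
  ring

theorem contDiff_iterate_exp (n : ℕ) : ContDiff ℝ ∞ (Real.exp^[n]) := by
  induction n with
  | zero => exact contDiff_id
  | succ n ih => exact ih.comp Real.contDiff_exp

theorem iterate_succ_exp_pos (n : ℕ) (x : ℝ) : 0 < Real.exp^[n + 1] x := by
  rw [Function.iterate_succ_apply']
  exact Real.exp_pos _

theorem iteratedDeriv_iterate_succ_exp_rpow (n : ℕ) (r : ℝ) (m : ℕ) (x : ℝ) :
    iteratedDeriv m (fun t : ℝ => (Real.exp^[n + 1] t) ^ r) x =
      ∑ l ∈ monotoneChains n m, chainTerm (n + 1) r x (shiftedExtension l) := by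
  induction n generalizing m x with
  | zero =>
    have hc : monotoneChains 0 m = {fun _ => Fin.last m} := by
      ext l
      simp only [monotoneChains, Finset.mem_filter, Finset.mem_univ, true_and,
        Finset.mem_singleton]
      constructor
      · rintro ⟨-, h⟩
        funext i
        rw [Fin.fin_one_eq_zero i]
        exact Fin.ext h
      · rintro rfl
        simp
    have he : (fun t : ℝ => (Real.exp^[0 + 1] t) ^ r) = fun t => Real.exp (r * t) := by
      funext t
      simp [← Real.exp_mul, mul_comm]
    rw [he, hc, Finset.sum_singleton, iteratedDeriv_exp_const_mul]
    simp [chainTerm, shiftedExtension, ← Real.exp_mul, mul_comm]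
  | succ n ih =>
    have hg : ContDiff ℝ ∞ fun t : ℝ => (Real.exp^[n + 1] t) ^ r :=
      (contDiff_iterate_exp (n + 1)).rpow_const_of_ne fun t => (iterate_succ_exp_pos n t).ne'
    rw [sum_monotoneChains_succ]
    refine (iteratedDeriv_comp_exp hg m x).trans (Finset.sum_congr rfl fun k _ => ?_)
    rw [ih, Finset.mul_sum]
    refine Finset.sum_congr rfl fun l hl => ?_
    have hk : shiftedExtension l (n + 1) = k := by
      simpa [shiftedExtension, Fin.last] using (Finset.mem_filter.1 hl).2.2
    rw [chainTerm_update, hk]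

/-- Expansion of the iterated exponential, second method: for `N ≥ 1`,
`(d/dx)^m (exp^[N] x)^r` equals the sum over all chains `0 ≤ l₁ ≤ l₂ ≤ ⋯ ≤ l_N = m`
(encoded as monotone functions `Fin N → Fin (m+1)` with last value `m`; index `k`
corresponds to `l_{k+1}`) of
`r^{l₁} (∏_{i=1}^{N−1} S₂(l_{i+1}, l_i)) (exp^[N] x)^r ∏_{i=1}^{N−1} (exp^[i] x)^{l_{N−i}}`. -/
theorem iteratedDeriv_iteratedExp_rpow_second (N : ℕ) (hN : 1 ≤ N) (r : ℝ) (m : ℕ)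
    (x : ℝ) :
    iteratedDeriv m (fun t : ℝ => (Real.exp^[N] t) ^ r) x =
      ∑ l ∈ Finset.univ.filter
          (fun l : Fin N → Fin (m + 1) =>
            (∀ i j, i ≤ j → l i ≤ l j) ∧ (l ⟨N - 1, by omega⟩ : ℕ) = m),
        (fun L : ℕ → ℕ =>
            r ^ (L 1) *
              (∏ i ∈ Finset.Ico 1 N, stirlingSecondComp (L (i + 1)) (L i)) *
              (Real.exp^[N] x) ^ r *
              ∏ i ∈ Finset.Ico 1 N, (Real.exp^[i] x) ^ ((L (N - i) : ℝ)))
          (fun i => if h : i - 1 < N then (l ⟨i - 1, h⟩ : ℕ) else 0) := by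
  obtain ⟨n, rfl⟩ := Nat.exists_eq_add_of_le' hN
  exact iteratedDeriv_iterate_succ_exp_rpow n r m x
end

section
/- Let r be a real number, let x > 1 be real, and let m ≥ 0. Then the m-th derivative at x of the function t ↦ (log t)^r (real power) equals m! · Σ_{j=0}^{m} C(r,j) · (−1)^{m−j} · (Σ 1/(m_1 · m_2 ⋯ m_j)) · x^{−m} · (log x)^{r−j}, where the inner sum is over all j-tuples (m_1, …, m_j) of positive integers with m_1 + ⋯ + m_j = m (for j = 0 the inner sum is 1 if m = 0 and 0 otherwise), and C(r,j) = (∏_{i=0}^{j−1}(r−i))/j! is the generalized binomial coefficient. -/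
/-- The power series `-log (1 - X) = ∑ Xⁿ / n`. -/
noncomputable def negLogOneSub : PowerSeries ℝ := PowerSeries.mk fun n => (n : ℝ)⁻¹

open PowerSeries in
lemma coeff_X_mul_derivative (P : PowerSeries ℝ) (m : ℕ) :
    coeff m (X * derivative ℝ P) = m * coeff m P := by
  cases m with
  | zero => simp
  | succ m =>
    rw [coeff_succ_X_mul, coeff_derivative]
    push_cast
    ring

open PowerSeries in
lemma derivative_negLogOneSub :
    derivative ℝ negLogOneSub = X * derivative ℝ negLogOneSub + 1 := by
  ext m
  rw [map_add, coeff_X_mul_derivative, coeff_derivative, coeff_one, negLogOneSub,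
    coeff_mk, coeff_mk]
  have h : ((m : ℝ) + 1) ≠ 0 := by positivity
  rcases Nat.eq_zero_or_pos m with rfl | hm
  · simp
  · have h' : (m : ℝ) ≠ 0 := by positivity
    simp [h, h', hm.ne']

open PowerSeries in
lemma coeff_succ_negLogOneSub_pow_succ (m j : ℕ) :
    coeff (m + 1) (negLogOneSub ^ (j + 1)) * (m + 1) =
      m * coeff m (negLogOneSub ^ (j + 1)) + (j + 1) * coeff m (negLogOneSub ^ j) := by
  have h : derivative ℝ (negLogOneSub ^ (j + 1)) =
      X * derivative ℝ (negLogOneSub ^ (j + 1)) + C ((j : ℝ) + 1) * negLogOneSub ^ j := by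
    rw [derivative_pow]
    simp only [Nat.add_sub_cancel, Nat.cast_add, Nat.cast_one, map_add, map_natCast, map_one]
    linear_combination (((j : PowerSeries ℝ) + 1) * negLogOneSub ^ j) * derivative_negLogOneSub
  have := congrArg (coeff m) h
  rwa [map_add, coeff_X_mul_derivative, coeff_derivative, coeff_C_mul] at this

/-- The exponential generating function of the unsigned Stirling numbers of the first kind. -/
lemma coeff_negLogOneSub_pow_mul_factorial (m j : ℕ) :
    PowerSeries.coeff m (negLogOneSub ^ j) * m.factorial = j.factorial * m.stirlingFirst j := by
  induction m generalizing j with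
  | zero => cases j <;> simp [negLogOneSub]
  | succ m ih =>
    cases j with
    | zero => simp [PowerSeries.coeff_one]
    | succ j =>
      have h₁ := ih (j + 1)
      have h₀ := ih j
      rw [Nat.stirlingFirst_succ_succ, Nat.factorial_succ m]
      push_cast [Nat.factorial_succ j] at h₁ ⊢
      linear_combination (m.factorial : ℝ) * coeff_succ_negLogOneSub_pow_succ m j
        + (m : ℝ) * h₁ + ((j : ℝ) + 1) * h₀

lemma coeff_negLogOneSub_pow (m j : ℕ) :
    PowerSeries.coeff m (negLogOneSub ^ j) =
      ∑ f ∈ (Finset.Nat.antidiagonalTuple j m).filter (fun f => ∀ i, 0 < f i),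
        ∏ i, (1 / (f i : ℝ)) := by
  have h : negLogOneSub ^ j = ∏ _i : Fin j, negLogOneSub := by simp
  rw [h, PowerSeries.coeff_prod, Finset.sum_filter_of_ne]
  · refine Finset.sum_equiv Finsupp.equivFunOnFinite ?_ ?_
    · simp [Finset.Nat.mem_antidiagonalTuple]
    · simp [negLogOneSub]
  · intro f _ hf i
    rw [Finset.prod_ne_zero_iff] at hf
    have := hf i (Finset.mem_univ i)
    refine Nat.pos_of_ne_zero fun h0 => this (by simp [h0])

lemma hasDerivAt_rpow_mul_log_rpow {x : ℝ} (hx : 1 < x) (a b : ℝ) :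
    HasDerivAt (fun t : ℝ => t ^ a * Real.log t ^ b)
      (a * x ^ (a - 1) * Real.log x ^ b + b * x ^ (a - 1) * Real.log x ^ (b - 1)) x := by
  have hx0 : 0 < x := by linarith
  have h := (Real.hasDerivAt_rpow_const (p := a) (Or.inl hx0.ne')).mul
    ((Real.hasDerivAt_log hx0.ne').rpow_const (p := b) (Or.inl (Real.log_pos hx).ne'))
  refine h.congr_deriv ?_
  rw [Real.rpow_sub_one hx0.ne']
  field_simp

/-- Derivatives of powers of the logarithm in terms of Stirling numbers of the first kind. -/
lemma iteratedDeriv_log_rpow_stirlingFirst (r : ℝ) (m : ℕ) {x : ℝ} (hx : 1 < x) :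
    iteratedDeriv m (fun t : ℝ => Real.log t ^ r) x =
      ∑ j ∈ Finset.range (m + 1), (∏ i ∈ Finset.range j, (r - i)) * (-1) ^ (m + j) *
        m.stirlingFirst j * (x ^ (-(m : ℝ)) * Real.log x ^ (r - j)) := by
  induction m generalizing x with
  | zero => simp
  | succ m ih =>
    have heq : iteratedDeriv m (fun t : ℝ => Real.log t ^ r) =ᶠ[nhds x] fun y =>
        ∑ j ∈ Finset.range (m + 1), (∏ i ∈ Finset.range j, (r - i)) * (-1) ^ (m + j) *
          m.stirlingFirst j * (y ^ (-(m : ℝ)) * Real.log y ^ (r - j)) := by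
      filter_upwards [Ioi_mem_nhds hx] with y hy using ih hy
    have hderiv := HasDerivAt.fun_sum (u := Finset.range (m + 1)) fun j _ =>
      (hasDerivAt_rpow_mul_log_rpow hx (-(m : ℝ)) (r - j)).const_mul
        ((∏ i ∈ Finset.range j, (r - i)) * (-1) ^ (m + j) * (m.stirlingFirst j : ℝ))
    rw [iteratedDeriv_succ, heq.deriv_eq, hderiv.deriv]
    set S : ℕ → ℝ := fun j => (∏ i ∈ Finset.range j, (r - i)) * (-1) ^ (m + 1 + j) *
      (m * m.stirlingFirst j) * (x ^ (-(m : ℝ) - 1) * Real.log x ^ (r - j)) with hS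
    have hS0 : S 0 = 0 := by cases m <;> simp [hS]
    have hSm : S (m + 1) = 0 := by
      simp [hS, Nat.stirlingFirst_eq_zero_of_lt (Nat.lt_succ_self m)]
    have hshift : ∑ j ∈ Finset.range (m + 1), S j = ∑ j ∈ Finset.range (m + 1), S (j + 1) := by
      have h := Finset.sum_range_succ' S (m + 1)
      rwa [Finset.sum_range_succ, hS0, hSm, add_zero, add_zero] at h
    rw [Finset.sum_range_succ' _ (m + 1)]
    have hexp : -((m + 1 : ℕ) : ℝ) = -(m : ℝ) - 1 := by push_cast; ring
    simp only [Nat.stirlingFirst_succ_zero, Nat.cast_zero, mul_zero, zero_mul, add_zero, hexp]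
    calc _ = ∑ j ∈ Finset.range (m + 1), S j + ∑ j ∈ Finset.range (m + 1),
          (∏ i ∈ Finset.range (j + 1), (r - i)) * (-1) ^ (m + j) * m.stirlingFirst j *
            (x ^ (-(m : ℝ) - 1) * Real.log x ^ (r - j - 1)) := by
          rw [← Finset.sum_add_distrib]
          refine Finset.sum_congr rfl fun j _ => ?_
          rw [hS, Finset.prod_range_succ]
          ring
      _ = _ := by
          rw [hshift, ← Finset.sum_add_distrib]
          refine Finset.sum_congr rfl fun j _ => ?_
          have he : r - ((j : ℝ) + 1) = r - j - 1 := by ring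
          simp only [hS, Nat.stirlingFirst_succ_succ, Nat.cast_add, Nat.cast_mul, Nat.cast_one, he]
          ring

/-- The `m`-th derivative of `t ↦ (log t)^r` (real power) at `x > 1`, second method:
`(d/dx)^m (log x)^r = m! Σ_{j=0}^{m} C(r,j) (−1)^{m−j} (Σ 1/(m₁⋯m_j)) x^{−m} (log x)^{r−j}`,
the inner sum being over all `j`-tuples of positive integers with `m₁ + ⋯ + m_j = m`,
and `C(r,j) = r(r−1)⋯(r−j+1)/j!`. -/
theorem iteratedDeriv_log_rpow_second (r : ℝ) (x : ℝ) (hx : 1 < x) (m : ℕ) :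
    iteratedDeriv m (fun t : ℝ => Real.log t ^ r) x =
      (m.factorial : ℝ) *
        ∑ j ∈ Finset.range (m + 1),
          ((∏ i ∈ Finset.range j, (r - i)) / j.factorial) * (-1) ^ (m - j) *
            (∑ f ∈ (Finset.Nat.antidiagonalTuple j m).filter (fun f => ∀ i, 0 < f i),
              ∏ i, (1 / (f i : ℝ))) *
            x ^ (-(m : ℝ)) * Real.log x ^ (r - j) := by
  rw [iteratedDeriv_log_rpow_stirlingFirst r m hx, Finset.mul_sum]
  refine Finset.sum_congr rfl fun j hj => ?_
  have hjm : j ≤ m := Nat.lt_succ_iff.mp (Finset.mem_range.mp hj)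
  have hsign : (-1 : ℝ) ^ (m + j) = (-1) ^ (m - j) := by
    obtain ⟨k, rfl⟩ := Nat.exists_eq_add_of_le hjm
    rw [Nat.add_sub_cancel_left, show j + k + j = k + 2 * j by ring, pow_add, pow_mul]
    simp
  have hstirling : (m.stirlingFirst j : ℝ) =
      PowerSeries.coeff m (negLogOneSub ^ j) * m.factorial / j.factorial := by
    rw [eq_div_iff (by positivity), coeff_negLogOneSub_pow_mul_factorial, mul_comm]
  rw [← coeff_negLogOneSub_pow, hsign, hstirling]
  ring
end
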